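/- Let n be a positive perfect square and let Q be an integral binary quadratic form of discriminant 4n. Then, as T → ∞, D_T^Q = 6·T·log T/(π²·n^{1/2}) + o(T·log T). -/

import Mathlib

open Filter Real Asymptotics

/-- The substitution action of `SL₂(ℤ)` on integral binary quadratic forms, where a form
`a x² + b x y + c y²` is encoded as the triple `(a, b, c)`: for `g = (p q; r s)` the form
`g • Q` is `(x, y) ↦ Q (p x + q y, r x + s y)`. -/
def actForm (g : Matrix.SpecialLinearGroup (Fin 2) ℤ) (Q : ℤ × ℤ × ℤ) : ℤ × ℤ × ℤ :=
  let p := (g : Matrix (Fin 2) (Fin 2) ℤ) 0 0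
  let q := (g : Matrix (Fin 2) (Fin 2) ℤ) 0 1
  let r := (g : Matrix (Fin 2) (Fin 2) ℤ) 1 0
  let s := (g : Matrix (Fin 2) (Fin 2) ℤ) 1 1
  (Q.1 * p ^ 2 + Q.2.1 * p * r + Q.2.2 * r ^ 2,
   2 * Q.1 * p * q + Q.2.1 * (p * s + q * r) + 2 * Q.2.2 * r * s,
   Q.1 * q ^ 2 + Q.2.1 * q * s + Q.2.2 * s ^ 2)

/-- Proper (`SL₂(ℤ)`) equivalence of integral binary quadratic forms. -/
def ProperEquiv (Q Q' : ℤ × ℤ × ℤ) : Prop := ∃ g, actForm g Q = Q'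

/-- `DTQ n Q T` is the number of `D(n)`-pairs `{a, c}` (written with `a > c`) with
`a, c ∈ {-T, …, T}` whose associated form `E_{ac} = [a, 2√(ac+n), c]` is properly
equivalent to `Q`. -/
noncomputable def DTQ (n : ℤ) (Q : ℤ × ℤ × ℤ) (T : ℝ) : ℕ :=
  Set.ncard {ac : ℤ × ℤ | ac.2 < ac.1 ∧ ac.1 ≠ 0 ∧ ac.2 ≠ 0 ∧
    |(ac.1 : ℝ)| ≤ T ∧ |(ac.2 : ℝ)| ≤ T ∧
    ∃ b : ℤ, 0 ≤ b ∧ b ^ 2 = ac.1 * ac.2 + n ∧ ProperEquiv (ac.1, 2 * b, ac.2) Q}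

/-- `FTQ Q T` is the number of integral binary quadratic forms `[a, b, c]` with
`|a| ≤ T`, `|c| ≤ T`, `a > c`, `b ≥ 0` which are properly equivalent to `Q`. -/
noncomputable def FTQ (Q : ℤ × ℤ × ℤ) (T : ℝ) : ℕ :=
  Set.ncard {f : ℤ × ℤ × ℤ | |(f.1 : ℝ)| ≤ T ∧ |(f.2.2 : ℝ)| ≤ T ∧
    f.2.2 < f.1 ∧ 0 ≤ f.2.1 ∧ ProperEquiv f Q}

/-- `ω(d)`: the number of `SL₂(ℤ)`-automorphs of a primitive definite form of
discriminant `d`. -/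
def omegaDisc (d : ℤ) : ℕ := if d = -4 then 4 else if d = -3 then 6 else 2

open Topology

theorem actForm_actForm (g h : Matrix.SpecialLinearGroup (Fin 2) ℤ) (Q : ℤ × ℤ × ℤ) :
    actForm g (actForm h Q) = actForm (h * g) Q := by
  simp only [actForm, Matrix.SpecialLinearGroup.coe_mul, Matrix.mul_apply, Fin.sum_univ_two,
    Prod.mk.injEq]
  refine ⟨?_, ?_, ?_⟩ <;> ring

theorem actForm_one (Q : ℤ × ℤ × ℤ) : actForm 1 Q = Q := by
  simp [actForm]

theorem actForm_neg_matrix (g : Matrix.SpecialLinearGroup (Fin 2) ℤ) (Q : ℤ × ℤ × ℤ) :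
    actForm (-g) Q = actForm g Q := by
  simp [actForm]

theorem ProperEquiv.symm {Q Q' : ℤ × ℤ × ℤ} (h : ProperEquiv Q Q') : ProperEquiv Q' Q := by
  obtain ⟨g, rfl⟩ := h
  exact ⟨g⁻¹, by rw [actForm_actForm, mul_inv_cancel, actForm_one]⟩

theorem ProperEquiv.trans {Q Q' Q'' : ℤ × ℤ × ℤ} (h : ProperEquiv Q Q')
    (h' : ProperEquiv Q' Q'') : ProperEquiv Q Q'' := by
  obtain ⟨g, rfl⟩ := h
  obtain ⟨g', rfl⟩ := h'
  exact ⟨g * g', (actForm_actForm _ _ _).symm⟩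

theorem actForm_neg_form (g : Matrix.SpecialLinearGroup (Fin 2) ℤ) (Q : ℤ × ℤ × ℤ) :
    actForm g (-Q) = -actForm g Q := by
  simp only [actForm, Prod.fst_neg, Prod.snd_neg, Prod.neg_mk, Prod.mk.injEq]
  refine ⟨?_, ?_, ?_⟩ <;> ring

theorem ProperEquiv.neg {Q Q' : ℤ × ℤ × ℤ} (h : ProperEquiv Q Q') :
    ProperEquiv (-Q) (-Q') := by
  obtain ⟨g, rfl⟩ := h
  exact ⟨g, actForm_neg_form _ _⟩

theorem properEquiv_swap (a b c : ℤ) : ProperEquiv (a, b, c) (c, -b, a) :=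
  ⟨⟨!![0, -1; 1, 0], by simp⟩, by simp [actForm]⟩

/-- A form of square discriminant `(2m)²` represents zero primitively, so it is equivalent to a
form whose last coefficient vanishes and whose middle coefficient is `2m`. -/
theorem exists_properEquiv_split {m : ℤ} (hm : 0 < m) {Q : ℤ × ℤ × ℤ}
    (hQ : Q.2.1 ^ 2 - 4 * Q.1 * Q.2.2 = 4 * m ^ 2) : ∃ A, ProperEquiv Q (A, 2 * m, 0) := by
  obtain ⟨a, b, c⟩ := Q
  simp only at hQ
  obtain ⟨k, rfl⟩ : (2 : ℤ) ∣ b := by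
    refine Int.prime_two.dvd_of_dvd_pow (n := 2) ⟨2 * (m ^ 2 + a * c), by linarith⟩
  have hk : k ^ 2 = a * c + m ^ 2 := by linarith
  obtain ⟨x, y, hxy, h1, h2⟩ : ∃ x y : ℤ, (x ≠ 0 ∨ y ≠ 0) ∧ a * x = (m - k) * y ∧
      (k + m) * x = -c * y := by
    by_cases ha : a = 0 ∧ k = m
    · obtain ⟨rfl, rfl⟩ := ha
      exact ⟨-c, 2 * k, by omega, by ring, by ring⟩
    · exact ⟨m - k, a, by omega, by ring, by linarith⟩
  have hg : 0 < Int.gcd x y := Int.gcd_pos_iff.2 hxy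
  obtain ⟨g, q, s, hg0, hco, rfl, rfl⟩ := Int.exists_gcd_one' hg
  have hg0' : (g : ℤ) ≠ 0 := by positivity
  have h1' : a * q = (m - k) * s := mul_right_cancel₀ hg0' (by linarith)
  have h2' : (k + m) * q = -c * s := mul_right_cancel₀ hg0' (by linarith)
  obtain ⟨r, p, hrp⟩ := Int.isCoprime_iff_gcd_eq_one.2 hco
  refine ⟨a * p ^ 2 + 2 * k * p * (-r) + c * r ^ 2,
    ⟨!![p, q; -r, s], by rw [Matrix.det_fin_two_of]; linarith⟩, ?_⟩
  simp only [actForm, Matrix.of_apply, Matrix.cons_val', Matrix.cons_val_zero,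
    Matrix.cons_val_one, Matrix.cons_val_fin_one, Prod.mk.injEq]
  refine ⟨by ring, ?_, ?_⟩
  · linear_combination 2 * p * h1' - 2 * r * h2' + 2 * m * hrp
  · linear_combination q * h1' + s * h2'

/-- The pairs `(x, y)` with `x` and `A x + 2 m y` positive and `x (A x + 2 m y) ≤ X`. -/
def hyperbolaPts (A m : ℤ) (X : ℝ) : Set (ℤ × ℤ) :=
  {x | 0 < x.1 ∧ 0 < A * x.1 + 2 * m * x.2 ∧ ((x.1 * (A * x.1 + 2 * m * x.2) : ℤ) : ℝ) ≤ X}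

/-- The primitive points of `hyperbolaPts`. -/
def primitivePts (A m : ℤ) (X : ℝ) : Set (ℤ × ℤ) :=
  {x ∈ hyperbolaPts A m X | IsCoprime x.1 x.2}

/-- The matrices `(p q; r s)` of determinant one, encoded as `((p, r), (q, s))`, carrying
`x (A x + 2 m y)` to a form `[a, 2b, c]` with `0 < c < a ≤ T`, normalised by `0 < p`, `0 < q`. -/
def positiveMatrices (A m : ℤ) (T : ℝ) : Set ((ℤ × ℤ) × (ℤ × ℤ)) :=
  {w | w.1.1 * w.2.2 - w.2.1 * w.1.2 = 1 ∧ w.1 ∈ hyperbolaPts A m T ∧ 0 < w.2.1 ∧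
    0 < A * w.2.1 + 2 * m * w.2.2 ∧
    w.2.1 * (A * w.2.1 + 2 * m * w.2.2) < w.1.1 * (A * w.1.1 + 2 * m * w.1.2)}

/-- The positive pairs counted by `DTQ (m ^ 2) Q T`. -/
def positivePairs (m : ℤ) (Q : ℤ × ℤ × ℤ) (T : ℝ) : Set (ℤ × ℤ) :=
  {ac | 0 < ac.2 ∧ ac.2 < ac.1 ∧ (ac.1 : ℝ) ≤ T ∧
    ∃ b : ℤ, 0 ≤ b ∧ b ^ 2 = ac.1 * ac.2 + m ^ 2 ∧ ProperEquiv (ac.1, 2 * b, ac.2) Q}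

/-- A point of `hyperbolaPts` is determined by the values of the two linear factors. -/
theorem injective_linearFactors {A m : ℤ} (hm : 0 < m) :
    Function.Injective fun x : ℤ × ℤ => (x.1, A * x.1 + 2 * m * x.2) := by
  rintro ⟨x, y⟩ ⟨x', y'⟩ h
  simp only [Prod.mk.injEq] at h
  obtain ⟨rfl, h⟩ := h
  have : 2 * m * y = 2 * m * y' := by linarith
  rw [mul_left_cancel₀ (by positivity) this]

theorem linearFactors_le {A m : ℤ} {X : ℝ} {x : ℤ × ℤ} (hx : x ∈ hyperbolaPts A m X) :
    x.1 ≤ ⌊X⌋ ∧ A * x.1 + 2 * m * x.2 ≤ ⌊X⌋ := by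
  obtain ⟨h1, h2, h3⟩ := hx
  have h4 := Int.le_floor.2 h3
  constructor <;> nlinarith

theorem finite_hyperbolaPts {A m : ℤ} (hm : 0 < m) (X : ℝ) : (hyperbolaPts A m X).Finite := by
  refine Set.Finite.of_finite_image (f := fun x => (x.1, A * x.1 + 2 * m * x.2)) ?_
    (injective_linearFactors hm).injOn
  refine (Set.finite_Icc ((1, 1) : ℤ × ℤ) (⌊X⌋, ⌊X⌋)).subset ?_
  rintro _ ⟨x, hx, rfl⟩
  have := linearFactors_le hx
  exact ⟨⟨hx.1, hx.2.1⟩, this⟩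

/-- Few points of `hyperbolaPts` have a small linear factor. -/
theorem ncard_small_factor_le {A m : ℤ} (hm : 0 < m) {X : ℝ} (hX : 0 ≤ X) :
    ({x ∈ hyperbolaPts A m X | x.1 ≤ 2 * m ∨ A * x.1 + 2 * m * x.2 ≤ 2 * m}.ncard : ℝ) ≤
      4 * m * X := by
  have hfl : 0 ≤ ⌊X⌋ := Int.floor_nonneg.2 hX
  have key : {x ∈ hyperbolaPts A m X | x.1 ≤ 2 * m ∨ A * x.1 + 2 * m * x.2 ≤ 2 * m}.ncard ≤
      (((Finset.Icc 1 (2 * m) ×ˢ Finset.Icc 1 ⌊X⌋) ∪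
        (Finset.Icc 1 ⌊X⌋ ×ˢ Finset.Icc 1 (2 * m)) : Finset (ℤ × ℤ)) : Set (ℤ × ℤ)).ncard := by
    refine Set.ncard_le_ncard_of_injOn (fun x => (x.1, A * x.1 + 2 * m * x.2)) ?_
      (injective_linearFactors hm).injOn (Finset.finite_toSet _)
    rintro x ⟨hx, hx'⟩
    have h := linearFactors_le hx
    obtain ⟨h1, h2, -⟩ := hx
    simp only [Finset.coe_union, Finset.coe_product, Finset.coe_Icc, Set.mem_union, Set.mem_prod,
      Set.mem_Icc]
    omega
  rw [Set.ncard_coe_finset] at key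
  have h2 := key.trans (Finset.card_union_le _ _)
  rw [Finset.card_product, Finset.card_product, Int.card_Icc, Int.card_Icc] at h2
  zify at h2
  rw [Int.toNat_of_nonneg (by omega), Int.toNat_of_nonneg (by omega)] at h2
  have h3 : ((Set.ncard {x ∈ hyperbolaPts A m X | x.1 ≤ 2 * m ∨
      A * x.1 + 2 * m * x.2 ≤ 2 * m} : ℤ) : ℝ) ≤ ((4 * m * ⌊X⌋ : ℤ) : ℝ) := by
    exact_mod_cast h2.trans (by linarith)
  push_cast at h3
  refine h3.trans ?_
  have : (0 : ℝ) < m := by exact_mod_cast hm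
  gcongr
  exact Int.floor_le X

theorem injOn_positiveMatrices_fst {A m : ℤ} (hm : 0 < m) (T : ℝ) :
    Set.InjOn Prod.fst (positiveMatrices A m T) := by
  have lt_of_mem : ∀ w ∈ positiveMatrices A m T, w.2.1 < w.1.1 := by
    rintro ⟨⟨p, r⟩, q, s⟩ ⟨hdet, ⟨hp, hv, -⟩, hq, hv', hlt⟩
    simp only at *
    by_contra! hpq
    have h : p * (A * q + 2 * m * s) = 2 * m + q * (A * p + 2 * m * r) := by
      linear_combination 2 * m * hdet
    have : A * p + 2 * m * r < A * q + 2 * m * s := by nlinarith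
    nlinarith
  rintro ⟨⟨p, r⟩, q, s⟩ hw ⟨⟨p', r'⟩, q', s'⟩ hw' h
  have h1 := lt_of_mem _ hw
  have h2 := lt_of_mem _ hw'
  obtain ⟨hdet, ⟨hp, -, -⟩, hq, -, -⟩ := hw
  obtain ⟨hdet', -, hq', -, -⟩ := hw'
  simp only [Prod.mk.injEq] at *
  obtain ⟨rfl, rfl⟩ := h
  have hdvd : p ∣ q - q' :=
    ⟨q * s' - q' * s, by linear_combination q' * hdet - q * hdet'⟩
  have hqq : q = q' := by
    have := Int.eq_zero_of_abs_lt_dvd hdvd (by rw [abs_lt]; constructor <;> linarith)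
    linarith
  subst hqq
  exact ⟨⟨rfl, rfl⟩, rfl, mul_left_cancel₀ hp.ne' (by linarith)⟩

theorem ncard_positiveMatrices_le {A m : ℤ} (hm : 0 < m) (T : ℝ) :
    (positiveMatrices A m T).ncard ≤ (primitivePts A m T).ncard := by
  refine Set.ncard_le_ncard_of_injOn Prod.fst ?_ (injOn_positiveMatrices_fst hm T)
    ((finite_hyperbolaPts hm T).subset (Set.sep_subset _ _))
  rintro ⟨⟨p, r⟩, q, s⟩ ⟨hdet, hw, -⟩
  exact ⟨hw, s, -q, by simp only at *; linarith⟩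

theorem exists_positiveMatrices_of_primitivePts {A m : ℤ} (hm : 0 < m) {T : ℝ} {x : ℤ × ℤ}
    (hx : x ∈ primitivePts A m T) (h1 : 2 * m < x.1) (h2 : 2 * m < A * x.1 + 2 * m * x.2) :
    ∃ w ∈ positiveMatrices A m T, w.1 = x := by
  obtain ⟨p, r⟩ := x
  obtain ⟨hx, s₀, t₀, hst⟩ := hx
  simp only at *
  obtain ⟨hp, hv, -⟩ := id hx
  simp only at hp hv
  obtain ⟨q, s, hdet, hq0, hqp⟩ : ∃ q s : ℤ, p * s - q * r = 1 ∧ 0 ≤ q ∧ q < p := by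
    refine ⟨-t₀ % p, s₀ - r * (-t₀ / p), ?_, Int.emod_nonneg _ hp.ne', Int.emod_lt_of_pos _ hp⟩
    linear_combination hst + r * (-Int.mul_ediv_add_emod (-t₀) p)
  have hq : 0 < q := by
    rcases hq0.lt_or_eq with h | rfl
    · exact h
    · have : p = 1 := Int.eq_one_of_dvd_one hp.le ⟨s, by linarith⟩
      omega
  have h : p * (A * q + 2 * m * s) = 2 * m + q * (A * p + 2 * m * r) := by
    linear_combination 2 * m * hdet
  have hpos : 0 < p * (A * q + 2 * m * s) := by rw [h]; positivity
  refine ⟨((p, r), (q, s)), ⟨hdet, hx, hq, pos_of_mul_pos_right hpos hp.le, ?_⟩, rfl⟩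
  simp only
  generalize A * p + 2 * m * r = v at *
  generalize A * q + 2 * m * s = v' at *
  refine lt_of_mul_lt_mul_left (a := p) ?_ hp.le
  have : p * (q * v') = q * (2 * m + q * v) := by rw [← h]; ring
  rw [this]
  nlinarith [mul_pos hq (sub_pos.2 h2), mul_pos hp hv,
    mul_nonneg (mul_nonneg (by linarith : 0 ≤ p - q - 1) (by linarith : 0 ≤ p + q)) hv.le]

theorem ncard_primitivePts_le {A m : ℤ} (hm : 0 < m) {T : ℝ} (hT : 0 ≤ T) :
    ((primitivePts A m T).ncard : ℝ) ≤ (positiveMatrices A m T).ncard + 4 * m * T := by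
  have hsub : primitivePts A m T ⊆ Prod.fst '' positiveMatrices A m T ∪
      {x ∈ hyperbolaPts A m T | x.1 ≤ 2 * m ∨ A * x.1 + 2 * m * x.2 ≤ 2 * m} := by
    intro x hx
    by_cases h : x.1 ≤ 2 * m ∨ A * x.1 + 2 * m * x.2 ≤ 2 * m
    · exact Or.inr ⟨hx.1, h⟩
    · push Not at h
      exact Or.inl (exists_positiveMatrices_of_primitivePts hm hx h.1 h.2)
  have himage : Prod.fst '' positiveMatrices A m T ⊆ hyperbolaPts A m T := by
    rintro _ ⟨w, hw, rfl⟩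
    exact hw.2.1
  have h1 := (Set.ncard_le_ncard hsub (((finite_hyperbolaPts hm T).subset himage).union
    ((finite_hyperbolaPts hm T).subset (Set.sep_subset _ _)))).trans (Set.ncard_union_le _ _)
  rw [(injOn_positiveMatrices_fst hm T).ncard_image] at h1
  have h2 := ncard_small_factor_le (A := A) hm hT
  have h3 : ((primitivePts A m T).ncard : ℝ) ≤ (positiveMatrices A m T).ncard +
      ({x ∈ hyperbolaPts A m T | x.1 ≤ 2 * m ∨ A * x.1 + 2 * m * x.2 ≤ 2 * m}.ncard : ℝ) := by
    exact_mod_cast h1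
  linarith

theorem injOn_positiveMatrices_pair {A m : ℤ} (hm : 0 < m) (T : ℝ) :
    Set.InjOn (fun w : (ℤ × ℤ) × (ℤ × ℤ) => (w.1.1 * (A * w.1.1 + 2 * m * w.1.2),
      w.2.1 * (A * w.2.1 + 2 * m * w.2.2))) (positiveMatrices A m T) := by
  rintro ⟨⟨p, r⟩, q, s⟩ ⟨hdet, ⟨hp, hv, -⟩, hq, hv', -⟩ ⟨⟨p', r'⟩, q', s'⟩
    ⟨hdet', ⟨hp', hw, -⟩, hq', hw', -⟩ heq
  simp only [Prod.mk.injEq] at *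
  obtain ⟨ha, hc⟩ := heq
  have h : p * (A * q + 2 * m * s) = 2 * m + q * (A * p + 2 * m * r) := by
    linear_combination 2 * m * hdet
  have h' : p' * (A * q' + 2 * m * s') = 2 * m + q' * (A * p' + 2 * m * r') := by
    linear_combination 2 * m * hdet'
  have hb : q * (A * p + 2 * m * r) = q' * (A * p' + 2 * m * r') := by
    have h1 := mul_pos hq hv
    have h2 := mul_pos hq' hw
    have h3 : (q * (A * p + 2 * m * r)) * (2 * m + q * (A * p + 2 * m * r)) =
        (q' * (A * p' + 2 * m * r')) * (2 * m + q' * (A * p' + 2 * m * r')) := by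
      rw [← h, ← h']
      linear_combination (q * (A * q + 2 * m * s)) * ha + p' * (A * p' + 2 * m * r') * hc
    nlinarith
  have hvw : A * p + 2 * m * r = A * p' + 2 * m * r' := by
    refine Int.dvd_antisymm hv.le hw.le ⟨p * s' - q * r', ?_⟩ ⟨p' * s - q' * r, ?_⟩
    · linear_combination -(A * p' + 2 * m * r') * hdet' - s' * ha + r' * hb
    · linear_combination -(A * p + 2 * m * r) * hdet + s * ha - r * hb
  rw [hvw] at ha hb
  obtain rfl := mul_right_cancel₀ hw.ne' ha
  obtain rfl := mul_right_cancel₀ hw.ne' hb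
  have h2m : 2 * m ≠ 0 := by positivity
  have hr : r = r' := mul_left_cancel₀ h2m (by linarith)
  have hs : s = s' := mul_left_cancel₀ h2m (by linarith [mul_left_cancel₀ hq.ne' hc])
  exact ⟨⟨rfl, hr⟩, rfl, hs⟩

theorem image_positiveMatrices {A m : ℤ} (hm : 0 < m) {Q : ℤ × ℤ × ℤ}
    (hQ : ProperEquiv Q (A, 2 * m, 0)) (T : ℝ) :
    (fun w : (ℤ × ℤ) × (ℤ × ℤ) => (w.1.1 * (A * w.1.1 + 2 * m * w.1.2),
      w.2.1 * (A * w.2.1 + 2 * m * w.2.2))) '' positiveMatrices A m T = positivePairs m Q T := by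
  ext ⟨a, c⟩
  constructor
  · rintro ⟨⟨⟨p, r⟩, q, s⟩, ⟨hdet, ⟨hp, hv, hT⟩, hq, hv', hlt⟩, h⟩
    simp only [Prod.mk.injEq] at *
    obtain ⟨rfl, rfl⟩ := h
    refine ⟨mul_pos hq hv', hlt, hT, q * (A * p + 2 * m * r) + m, ?_, ?_, ?_⟩
    · have := mul_pos hq hv
      linarith
    · linear_combination -2 * m * q * (A * p + 2 * m * r) * hdet
    · refine (hQ.trans ⟨⟨!![p, q; r, s], by rw [Matrix.det_fin_two_of]; linarith⟩, ?_⟩).symm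
      simp only [actForm, Matrix.of_apply, Matrix.cons_val', Matrix.cons_val_zero,
        Matrix.cons_val_one, Matrix.cons_val_fin_one, Prod.mk.injEq]
      refine ⟨by ring, ?_, by ring⟩
      linear_combination 2 * m * hdet
  · rintro ⟨hc, hca, hT, b, hb, hbac, hE⟩
    simp only at *
    obtain ⟨g, hg, hp⟩ : ∃ g, actForm g (A, 2 * m, 0) = (a, 2 * b, c) ∧
        0 ≤ (g : Matrix (Fin 2) (Fin 2) ℤ) 0 0 := by
      obtain ⟨g, hg⟩ := (hE.trans hQ).symm
      rcases le_total 0 ((g : Matrix (Fin 2) (Fin 2) ℤ) 0 0) with h | h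
      · exact ⟨g, hg, h⟩
      · exact ⟨-g, by rw [actForm_neg_matrix, hg], by simpa using h⟩
    have hdet := Matrix.det_fin_two (g : Matrix (Fin 2) (Fin 2) ℤ)
    rw [g.det_coe] at hdet
    simp only [actForm, Prod.mk.injEq] at hg
    generalize (g : Matrix (Fin 2) (Fin 2) ℤ) 0 0 = p at *
    generalize (g : Matrix (Fin 2) (Fin 2) ℤ) 0 1 = q at *
    generalize (g : Matrix (Fin 2) (Fin 2) ℤ) 1 0 = r at *
    generalize (g : Matrix (Fin 2) (Fin 2) ℤ) 1 1 = s at *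
    obtain ⟨ha, hb2, hc2⟩ := hg
    have ha' : p * (A * p + 2 * m * r) = a := by linarith
    have hc' : q * (A * q + 2 * m * s) = c := by linarith
    have hv : 0 < A * p + 2 * m * r :=
      pos_of_mul_pos_right (by rw [ha']; linarith) hp
    have hp' : 0 < p := pos_of_mul_pos_left (by rw [ha']; linarith) hv.le
    have hmb : m < b := by nlinarith [mul_pos hc (hc.trans hca)]
    have hqv : q * (A * p + 2 * m * r) = b - m := by
      have : 2 * (q * (A * p + 2 * m * r)) = 2 * (b - m) := by
        linear_combination hb2 + 2 * m * hdet
      linarith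
    have hq : 0 < q := pos_of_mul_pos_left (by rw [hqv]; linarith) hv.le
    have hv' : 0 < A * q + 2 * m * s := pos_of_mul_pos_right (by rw [hc']; exact hc) hq.le
    refine ⟨((p, r), (q, s)), ⟨hdet.symm, ⟨hp', hv, ?_⟩, hq, hv', ?_⟩, ?_⟩
    · simp only
      rwa [ha']
    · simp only
      rwa [ha', hc']
    · simp only [ha', hc']

theorem ncard_positivePairs {A m : ℤ} (hm : 0 < m) {Q : ℤ × ℤ × ℤ}
    (hQ : ProperEquiv Q (A, 2 * m, 0)) (T : ℝ) :
    (positivePairs m Q T).ncard = (positiveMatrices A m T).ncard := by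
  rw [← image_positiveMatrices hm hQ T, (injOn_positiveMatrices_pair hm T).ncard_image]

theorem finite_positivePairs (m : ℤ) (Q : ℤ × ℤ × ℤ) (T : ℝ) : (positivePairs m Q T).Finite := by
  refine (Set.finite_Icc ((0, 0) : ℤ × ℤ) (⌊T⌋, ⌊T⌋)).subset ?_
  rintro ⟨a, c⟩ ⟨hc, hca, hT, -⟩
  have := Int.le_floor.2 hT
  simp only [Set.mem_Icc, Prod.mk_le_mk] at *
  omega

/-- The set of pairs counted by `DTQ (m ^ 2) Q T`. -/
def signedPairs (m : ℤ) (Q : ℤ × ℤ × ℤ) (T : ℝ) : Set (ℤ × ℤ) :=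
  {ac | ac.2 < ac.1 ∧ ac.1 ≠ 0 ∧ ac.2 ≠ 0 ∧ |(ac.1 : ℝ)| ≤ T ∧ |(ac.2 : ℝ)| ≤ T ∧
    ∃ b : ℤ, 0 ≤ b ∧ b ^ 2 = ac.1 * ac.2 + m ^ 2 ∧ ProperEquiv (ac.1, 2 * b, ac.2) Q}

theorem injective_negSwap : Function.Injective fun x : ℤ × ℤ => (-x.2, -x.1) := by
  rintro ⟨a, c⟩ ⟨a', c'⟩ h
  simp only [Prod.mk.injEq, neg_inj] at h
  rw [h.1, h.2]

theorem negSwap_mem_signedPairs {m : ℤ} {Q : ℤ × ℤ × ℤ} {T : ℝ} {x : ℤ × ℤ}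
    (hx : x ∈ positivePairs m (-Q) T) :
    (-x.2, -x.1) ∈ signedPairs m Q T ∧ -x.2 < 0 := by
  obtain ⟨a, c⟩ := x
  obtain ⟨hc, hca, hT, b, hb, hbac, hE⟩ := hx
  simp only at *
  refine ⟨⟨by simpa, by simpa using hc.ne', by simpa using (hc.trans hca).ne', ?_, ?_,
    b, hb, by linarith, ?_⟩, by linarith⟩
  · rw [Int.cast_neg, abs_neg, abs_of_pos (by exact_mod_cast hc)]
    exact le_trans (by exact_mod_cast hca.le) hT
  · rw [Int.cast_neg, abs_neg, abs_of_pos (by exact_mod_cast hc.trans hca)]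
    exact hT
  · have := ((properEquiv_swap a (2 * b) c).symm.trans hE).neg
    simpa using this

theorem mem_signedPairs_of_pos {m : ℤ} {Q : ℤ × ℤ × ℤ} {T : ℝ} {x : ℤ × ℤ} :
    x ∈ positivePairs m Q T ↔ x ∈ signedPairs m Q T ∧ 0 < x.2 := by
  obtain ⟨a, c⟩ := x
  constructor
  · rintro ⟨hc, hca, hT, h⟩
    simp only at *
    have ha := hc.trans hca
    refine ⟨⟨hca, ha.ne', hc.ne', ?_, ?_, h⟩, hc⟩
    · rwa [abs_of_pos (by exact_mod_cast ha)]
    · rw [abs_of_pos (by exact_mod_cast hc)]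
      exact le_trans (by exact_mod_cast hca.le) hT
  · rintro ⟨⟨hca, -, -, hT, -, h⟩, hc⟩
    exact ⟨hc, hca, (le_abs_self _).trans hT, h⟩

theorem signedPairs_eq (m : ℤ) (Q : ℤ × ℤ × ℤ) (T : ℝ) :
    signedPairs m Q T = positivePairs m Q T ∪
      (fun x : ℤ × ℤ => (-x.2, -x.1)) '' positivePairs m (-Q) T ∪
      {x ∈ signedPairs m Q T | 0 < x.1 ∧ x.2 < 0} := by
  ext x
  constructor
  · intro hx
    rcases lt_or_ge 0 x.2 with h2 | h2
    · exact Or.inl (Or.inl (mem_signedPairs_of_pos.2 ⟨hx, h2⟩))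
    rcases lt_or_ge 0 x.1 with h1 | h1
    · exact Or.inr ⟨hx, h1, h2.lt_of_ne hx.2.2.1⟩
    · refine Or.inl (Or.inr ⟨(-x.2, -x.1), ?_, by simp⟩)
      obtain ⟨a, c⟩ := x
      obtain ⟨hca, ha, hc, -, hT, b, hb, hbac, hE⟩ := hx
      simp only at *
      refine ⟨by simp only; omega, by simpa, ?_, b, hb, by simp only; linarith, ?_⟩
      · push_cast
        exact (neg_le_abs _).trans hT
      · simpa using (properEquiv_swap a (2 * b) c).symm.trans hE |>.neg
  · rintro ((hx | ⟨x, hx, rfl⟩) | hx)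
    · exact (mem_signedPairs_of_pos.1 hx).1
    · exact (negSwap_mem_signedPairs hx).1
    · exact hx.1

theorem mixedPairs_subset (m : ℤ) (Q : ℤ × ℤ × ℤ) (T : ℝ) :
    {x ∈ signedPairs m Q T | 0 < x.1 ∧ x.2 < 0} ⊆
      Set.Icc (-m ^ 2, -m ^ 2) (m ^ 2, m ^ 2) := by
  rintro ⟨a, c⟩ ⟨⟨-, -, -, -, -, b, -, hbac, -⟩, ha, hc⟩
  simp only [Set.mem_Icc, Prod.mk_le_mk] at *
  refine ⟨⟨?_, ?_⟩, ?_, ?_⟩ <;> nlinarith [sq_nonneg b, sq_nonneg m]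

/-- Up to a bounded error, the signed pairs are counted by two families of positive pairs. -/
theorem ncard_signedPairs_bounds (m : ℤ) (Q : ℤ × ℤ × ℤ) (T : ℝ) :
    (positivePairs m Q T).ncard + (positivePairs m (-Q) T).ncard ≤ (signedPairs m Q T).ncard ∧
    (signedPairs m Q T).ncard ≤ (positivePairs m Q T).ncard + (positivePairs m (-Q) T).ncard +
      (Set.Icc ((-m ^ 2, -m ^ 2) : ℤ × ℤ) (m ^ 2, m ^ 2)).ncard := by
  have hmixed : {x ∈ signedPairs m Q T | 0 < x.1 ∧ x.2 < 0}.Finite :=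
    (Set.finite_Icc _ _).subset (mixedPairs_subset m Q T)
  have hunion := (finite_positivePairs m Q T).union
    ((finite_positivePairs m (-Q) T).image fun x : ℤ × ℤ => (-x.2, -x.1))
  have hdisj : Disjoint (positivePairs m Q T)
      ((fun x : ℤ × ℤ => (-x.2, -x.1)) '' positivePairs m (-Q) T) := by
    rw [Set.disjoint_left]
    rintro _ hx ⟨y, hy, rfl⟩
    have h1 := hx.1
    have h2 := hy.1
    have h3 := hy.2.1
    simp only at h1
    omega
  have hcard := Set.ncard_union_eq hdisj (finite_positivePairs m Q T)
    ((finite_positivePairs m (-Q) T).image fun x : ℤ × ℤ => (-x.2, -x.1))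
  rw [injective_negSwap.injOn.ncard_image] at hcard
  rw [signedPairs_eq m Q T, ← hcard]
  refine ⟨Set.ncard_le_ncard Set.subset_union_left (hunion.union hmixed), ?_⟩
  refine (Set.ncard_union_le _ _).trans (Nat.add_le_add_left ?_ _)
  exact Set.ncard_le_ncard (mixedPairs_subset m Q T) (Set.finite_Icc _ _)

theorem hyperbolaPts_eq_empty {A m : ℤ} {X : ℝ} (hX : X < 1) : hyperbolaPts A m X = ∅ := by
  ext x
  simp only [Set.mem_empty_iff_false, iff_false]
  intro hx
  have h1 := (linearFactors_le hx).1
  have h2 := hx.1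
  have : ⌊X⌋ < 1 := Int.floor_lt.2 (by exact_mod_cast hX)
  omega

theorem abs_card_Ioc_floor_sub_le {a b : ℝ} (hab : a ≤ b) :
    |((Finset.Ioc ⌊a⌋ ⌊b⌋).card : ℝ) - (b - a)| ≤ 1 := by
  have h : ((Finset.Ioc ⌊a⌋ ⌊b⌋).card : ℤ) = ⌊b⌋ - ⌊a⌋ := by
    rw [Int.card_Ioc, Int.toNat_of_nonneg (sub_nonneg.2 (Int.floor_mono hab))]
  have h' : ((Finset.Ioc ⌊a⌋ ⌊b⌋).card : ℝ) = ⌊b⌋ - ⌊a⌋ := by exact_mod_cast h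
  rw [h', abs_le]
  constructor <;>
    linarith [Int.floor_le a, Int.floor_le b, Int.lt_floor_add_one a, Int.lt_floor_add_one b]

theorem ncard_hyperbolaPts {A m : ℤ} (hm : 0 < m) (X : ℝ) :
    (hyperbolaPts A m X).ncard = ∑ p ∈ Finset.Icc 1 ⌊X⌋₊,
      (Finset.Ioc ⌊-(A * p : ℝ) / (2 * m)⌋ ⌊(X / p - A * p : ℝ) / (2 * m)⌋).card := by
  have hm' : (0 : ℝ) < 2 * m := by have : (0 : ℝ) < m := Int.cast_pos.2 hm; positivity
  rw [← Finset.card_sigma, ← Set.ncard_coe_finset]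
  symm
  refine Set.ncard_congr (fun x _ => ((x.1 : ℤ), x.2)) ?_ ?_ ?_
  · rintro ⟨p, r⟩ h
    simp only [SetLike.mem_coe, Finset.mem_sigma, Finset.mem_Icc, Finset.mem_Ioc, Int.floor_lt,
      Int.le_floor, div_lt_iff₀ hm', le_div_iff₀ hm'] at h
    obtain ⟨⟨hp, -⟩, h1, h2⟩ := h
    have hp' : (0 : ℝ) < p := by exact_mod_cast hp
    refine ⟨Int.natCast_pos.2 hp, ?_, ?_⟩
    · have : (0 : ℝ) < ((A * p + 2 * m * r : ℤ) : ℝ) := by push_cast; linarith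
      exact_mod_cast this
    · have h3 : (A * p + 2 * m * r : ℝ) ≤ X / p := by linarith
      rw [le_div_iff₀ hp'] at h3
      push_cast
      linarith
  · rintro ⟨p, r⟩ ⟨p', r'⟩ - - h
    simp only [Prod.mk.injEq, Nat.cast_inj] at h
    obtain ⟨rfl, rfl⟩ := h
    rfl
  · rintro ⟨p, r⟩ h
    have hle := (linearFactors_le h).1
    obtain ⟨hp, h1, h2⟩ := h
    simp only at hp h1 h2 hle
    lift p to ℕ using hp.le
    have hp' : (0 : ℝ) < p := by exact_mod_cast hp
    refine ⟨⟨p, r⟩, ?_, rfl⟩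
    simp only [SetLike.mem_coe, Finset.mem_sigma, Finset.mem_Icc, Finset.mem_Ioc, Int.floor_lt,
      Int.le_floor, div_lt_iff₀ hm', le_div_iff₀ hm']
    refine ⟨⟨by exact_mod_cast hp, Nat.le_floor (by exact_mod_cast Int.le_floor.1 hle)⟩, ?_, ?_⟩
    · have : (0 : ℝ) < ((A * p + 2 * m * r : ℤ) : ℝ) := by exact_mod_cast h1
      push_cast at this
      linarith
    · have h3 : (A * p + 2 * m * r : ℝ) ≤ X / p := by
        rw [le_div_iff₀ hp']
        push_cast at h2
        linarith
      linarith

theorem abs_ncard_hyperbolaPts_sub_le {A m : ℤ} (hm : 0 < m) {X : ℝ} (hX : 1 ≤ X) :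
    |((hyperbolaPts A m X).ncard : ℝ) - X * Real.log X / (2 * m)| ≤ 2 * X := by
  have hX0 : 0 ≤ X := zero_le_one.trans hX
  have hm1 : (1 : ℝ) ≤ m := by exact_mod_cast hm
  have hm' : (0 : ℝ) < 2 * m := by linarith
  have h1 : |((hyperbolaPts A m X).ncard : ℝ) - X / (2 * m) * harmonic ⌊X⌋₊| ≤ X := by
    rw [ncard_hyperbolaPts hm X, harmonic_eq_sum_Icc]
    push_cast
    rw [Finset.mul_sum, ← Finset.sum_sub_distrib]
    refine (Finset.abs_sum_le_sum_abs _ _).trans ?_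
    refine (Finset.sum_le_card_nsmul _ _ 1 fun p hp => ?_).trans ?_
    · have hp' : (0 : ℝ) < p := by exact_mod_cast (Finset.mem_Icc.1 hp).1
      have h : X / (2 * m) * (p : ℝ)⁻¹ = (X / p - A * p) / (2 * m) - -(A * p) / (2 * m) := by
        field_simp
        ring
      rw [h]
      refine abs_card_Ioc_floor_sub_le ?_
      have : 0 ≤ X / p := by positivity
      gcongr
      linarith
    · rw [Nat.card_Icc, nsmul_eq_mul, mul_one]
      simpa using Nat.floor_le hX0
  have h2 : |X / (2 * m) * harmonic ⌊X⌋₊ - X * Real.log X / (2 * m)| ≤ X := by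
    have h3 := log_le_harmonic_floor X hX0
    have h4 := harmonic_floor_le_one_add_log X hX
    have h5 : X / (2 * m) * harmonic ⌊X⌋₊ - X * Real.log X / (2 * m) =
        X / (2 * m) * (harmonic ⌊X⌋₊ - Real.log X) := by ring
    rw [h5, abs_of_nonneg (mul_nonneg (by positivity) (by linarith))]
    calc X / (2 * m) * (harmonic ⌊X⌋₊ - Real.log X) ≤ X / (2 * m) * 1 := by gcongr; linarith
      _ ≤ X := by rw [mul_one]; exact div_le_self hX0 (by linarith)
  calc _ ≤ _ := abs_sub_le _ (X / (2 * m) * harmonic ⌊X⌋₊) _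
    _ ≤ 2 * X := by linarith

theorem ncard_hyperbolaPts_le {A m : ℤ} (hm : 0 < m) {X L : ℝ} (hX : 0 ≤ X) (hL : 0 ≤ L)
    (hlog : 1 ≤ X → Real.log X ≤ L) :
    ((hyperbolaPts A m X).ncard : ℝ) ≤ X * (L + 2) := by
  rcases lt_or_ge X 1 with h | h
  · rw [hyperbolaPts_eq_empty h, Set.ncard_empty, Nat.cast_zero]
    positivity
  · have h1 := (abs_le.1 (abs_ncard_hyperbolaPts_sub_le (A := A) hm h)).2
    have hm1 : (1 : ℝ) ≤ m := by exact_mod_cast hm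
    have h2 : X * Real.log X / (2 * m) ≤ X * Real.log X :=
      div_le_self (mul_nonneg hX (Real.log_nonneg h)) (by linarith)
    have h3 := mul_le_mul_of_nonneg_left (hlog h) hX
    linarith

theorem tendsto_ncard_hyperbolaPts {A m : ℤ} (hm : 0 < m) :
    Tendsto (fun X : ℝ => ((hyperbolaPts A m X).ncard : ℝ) / (X * Real.log X)) atTop
      (𝓝 (1 / (2 * m))) := by
  have hlog : Tendsto (fun X : ℝ => 2 / Real.log X) atTop (𝓝 0) :=
    Real.tendsto_log_atTop.const_div_atTop 2
  rw [tendsto_iff_norm_sub_tendsto_zero]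
  refine squeeze_zero' (Eventually.of_forall fun _ => norm_nonneg _) ?_ hlog
  filter_upwards [eventually_gt_atTop 1] with X hX
  have hX0 : 0 < X := by linarith
  have hl := Real.log_pos hX
  have hm1 : (0 : ℝ) < m := by exact_mod_cast hm
  have h : ((hyperbolaPts A m X).ncard : ℝ) / (X * Real.log X) - 1 / (2 * m) =
      ((hyperbolaPts A m X).ncard - X * Real.log X / (2 * m)) / (X * Real.log X) := by
    field_simp
  rw [h, norm_div, Real.norm_eq_abs, Real.norm_eq_abs, abs_of_pos (mul_pos hX0 hl),
    div_le_div_iff₀ (by positivity) hl]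
  have := abs_ncard_hyperbolaPts_sub_le (A := A) hm hX.le
  nlinarith

theorem tendsto_ncard_hyperbolaPts_div_sq {A m : ℤ} (hm : 0 < m) {d : ℕ} (hd : d ≠ 0) :
    Tendsto (fun T : ℝ => ((hyperbolaPts A m (T / d ^ 2)).ncard : ℝ) / (T * Real.log T)) atTop
      (𝓝 (1 / (2 * m) * (1 / d ^ 2))) := by
  have hd0 : (0 : ℝ) < (d : ℝ) ^ 2 := by positivity
  have h1 := (tendsto_ncard_hyperbolaPts (A := A) hm).comp (tendsto_id.atTop_div_const hd0)
  have h2 : Tendsto (fun T : ℝ => 1 / (d : ℝ) ^ 2 *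
      (1 - Real.log ((d : ℝ) ^ 2) / Real.log T)) atTop (𝓝 (1 / (d : ℝ) ^ 2)) := by
    have h := ((Real.tendsto_log_atTop.const_div_atTop
      (Real.log ((d : ℝ) ^ 2))).const_sub 1).const_mul (1 / (d : ℝ) ^ 2)
    rwa [sub_zero, mul_one] at h
  refine (h1.mul h2).congr' ?_
  filter_upwards [eventually_gt_atTop 1, eventually_gt_atTop ((d : ℝ) ^ 2)] with T hT hTd
  have hT0 : 0 < T := by linarith
  have hl := Real.log_pos hT
  have hl2 : 0 < Real.log (T / (d : ℝ) ^ 2) := Real.log_pos ((one_lt_div hd0).2 hTd)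
  have h3 : 1 - Real.log ((d : ℝ) ^ 2) / Real.log T =
      Real.log (T / (d : ℝ) ^ 2) / Real.log T := by
    rw [Real.log_div hT0.ne' hd0.ne']
    field_simp
  simp only [Function.comp_apply, id_eq, h3]
  field_simp

theorem tsum_moebius_div_sq :
    ∑' d : ℕ, (ArithmeticFunction.moebius d : ℝ) * (1 / (d : ℝ) ^ 2) = 6 / π ^ 2 := by
  have h := ArithmeticFunction.LSeries_zeta_mul_Lseries_moebius (s := 2) (by norm_num)
  rw [ArithmeticFunction.LSeries_zeta_eq_riemannZeta (by norm_num), riemannZeta_two] at h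
  have h2 : LSeries (fun n => (ArithmeticFunction.moebius n : ℂ)) 2 =
      ((∑' d : ℕ, (ArithmeticFunction.moebius d : ℝ) * (1 / (d : ℝ) ^ 2) : ℝ) : ℂ) := by
    rw [LSeries, Complex.ofReal_tsum]
    refine tsum_congr fun d => ?_
    rcases eq_or_ne d 0 with rfl | hd
    · simp
    · rw [LSeries.term_of_ne_zero hd]
      push_cast
      rw [show (2 : ℂ) = ((2 : ℕ) : ℂ) by norm_num, Complex.cpow_natCast, mul_one_div]
  rw [h2] at h
  have h3 : π ^ 2 / 6 *
      ∑' d : ℕ, (ArithmeticFunction.moebius d : ℝ) * (1 / (d : ℝ) ^ 2) = 1 := by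
    exact_mod_cast h
  have hpi := Real.pi_pos
  field_simp at h3 ⊢
  linarith

theorem sum_moebius_Icc_filter_dvd {g N : ℕ} (hg : g ≠ 0) (hN : g ≤ N) :
    ∑ d ∈ Finset.Icc 1 N with d ∣ g, ArithmeticFunction.moebius d = if g = 1 then 1 else 0 := by
  rw [← ArithmeticFunction.one_apply, ← ArithmeticFunction.moebius_mul_coe_zeta,
    ArithmeticFunction.coe_mul_zeta_apply]
  refine Finset.sum_congr ?_ fun _ _ => rfl
  ext d
  simp only [Finset.mem_filter, Finset.mem_Icc, Nat.mem_divisors]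
  constructor
  · rintro ⟨-, h⟩
    exact ⟨h, hg⟩
  · rintro ⟨h, -⟩
    have h1 := Nat.pos_of_dvd_of_pos h (Nat.pos_of_ne_zero hg)
    have h2 := Nat.le_of_dvd (Nat.pos_of_ne_zero hg) h
    exact ⟨⟨h1, h2.trans hN⟩, h⟩

theorem image_hyperbolaPts_div_sq (A m : ℤ) (T : ℝ) {d : ℕ} (hd : 0 < d) :
    (fun x : ℤ × ℤ => (d * x.1, d * x.2)) '' hyperbolaPts A m (T / d ^ 2) =
      {x ∈ hyperbolaPts A m T | d ∣ Int.gcd x.1 x.2} := by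
  have hd' : (0 : ℤ) < d := by exact_mod_cast hd
  have hdR : (0 : ℝ) < (d : ℝ) ^ 2 := by positivity
  have key : ∀ p r : ℤ, (d * p, d * r) ∈ hyperbolaPts A m T ↔
      (p, r) ∈ hyperbolaPts A m (T / d ^ 2) := by
    intro p r
    have h1 : A * (d * p) + 2 * m * (d * r) = d * (A * p + 2 * m * r) := by ring
    have h2 : (((d * p) * (d * (A * p + 2 * m * r)) : ℤ) : ℝ) =
        ((p * (A * p + 2 * m * r) : ℤ) : ℝ) * d ^ 2 := by push_cast; ring
    simp only [hyperbolaPts, Set.mem_ofPred_eq]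
    rw [h1, h2, le_div_iff₀ hdR, mul_pos_iff_of_pos_left hd', mul_pos_iff_of_pos_left hd']
  ext ⟨x, y⟩
  constructor
  · rintro ⟨⟨p, r⟩, hp, h⟩
    rw [← h]
    exact ⟨(key p r).2 hp, Int.dvd_gcd (dvd_mul_right _ _) (dvd_mul_right _ _)⟩
  · rintro ⟨hx, hdvd⟩
    have hdvd' : (d : ℤ) ∣ Int.gcd x y := by exact_mod_cast hdvd
    obtain ⟨p, rfl⟩ := hdvd'.trans (Int.gcd_dvd_left ..)
    obtain ⟨r, rfl⟩ := hdvd'.trans (Int.gcd_dvd_right ..)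
    exact ⟨(p, r), (key p r).1 hx, rfl⟩

/-- Möbius inversion for the primitive points. -/
theorem ncard_primitivePts {A m : ℤ} (hm : 0 < m) (T : ℝ) :
    ((primitivePts A m T).ncard : ℝ) =
      ∑' d : ℕ, (ArithmeticFunction.moebius d : ℝ) * (hyperbolaPts A m (T / d ^ 2)).ncard := by
  have hfin := finite_hyperbolaPts (A := A) hm T
  rw [tsum_eq_sum (s := Finset.Icc 1 ⌊T⌋₊)]
  · have hcard : ∀ d ∈ Finset.Icc 1 ⌊T⌋₊, (hyperbolaPts A m (T / (d : ℝ) ^ 2)).ncard =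
        (hfin.toFinset.filter fun x => d ∣ Int.gcd x.1 x.2).card := by
      intro d hd
      have hd0 := (Finset.mem_Icc.1 hd).1
      have hinj : Function.Injective fun x : ℤ × ℤ => ((d : ℤ) * x.1, (d : ℤ) * x.2) := by
        have hd' : (d : ℤ) ≠ 0 := by positivity
        rintro ⟨p, r⟩ ⟨p', r'⟩ h
        simp only [Prod.mk.injEq, mul_eq_mul_left_iff, hd', or_false] at h
        rw [h.1, h.2]
      rw [← hinj.injOn.ncard_image, image_hyperbolaPts_div_sq A m T hd0, ← Set.ncard_coe_finset]
      simp
    have hprim : (primitivePts A m T).ncard =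
        (hfin.toFinset.filter fun x => Int.gcd x.1 x.2 = 1).card := by
      rw [← Set.ncard_coe_finset]
      simp [primitivePts, Int.isCoprime_iff_gcd_eq_one]
    have hint : ((primitivePts A m T).ncard : ℤ) = ∑ d ∈ Finset.Icc 1 ⌊T⌋₊,
        ArithmeticFunction.moebius d * (hyperbolaPts A m (T / (d : ℝ) ^ 2)).ncard := by
      rw [hprim, Finset.card_filter]
      push_cast
      have h1 : ∀ x ∈ hfin.toFinset, (if Int.gcd x.1 x.2 = 1 then (1 : ℤ) else 0) =
          ∑ d ∈ Finset.Icc 1 ⌊T⌋₊,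
            if d ∣ Int.gcd x.1 x.2 then ArithmeticFunction.moebius d else 0 := by
        intro x hx
        have hx' := (Set.Finite.mem_toFinset hfin).1 hx
        have hx1 := hx'.1
        have h2 : Int.gcd x.1 x.2 ≤ x.1 := Int.gcd_le_left _ hx1
        have h3 := Int.le_floor.1 (h2.trans (linearFactors_le hx').1)
        rw [← Finset.sum_filter, sum_moebius_Icc_filter_dvd
          (Int.gcd_pos_of_ne_zero_left _ hx1.ne').ne' (Nat.le_floor (by exact_mod_cast h3))]
      rw [Finset.sum_congr rfl h1, Finset.sum_comm]
      refine Finset.sum_congr rfl fun d hd => ?_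
      rw [hcard d hd, ← Finset.sum_filter, Finset.sum_const, nsmul_eq_mul, mul_comm]
    exact_mod_cast congrArg (Int.cast : ℤ → ℝ) hint
  · intro d hd
    rcases Nat.eq_zero_or_pos d with rfl | hd0
    · simp
    · have hdT : T < d := by
        refine Nat.lt_of_floor_lt ?_
        by_contra! h
        exact hd (Finset.mem_Icc.2 ⟨hd0, h⟩)
      have hd1 : (1 : ℝ) ≤ d := by exact_mod_cast hd0
      rw [hyperbolaPts_eq_empty, Set.ncard_empty, Nat.cast_zero, mul_zero]
      rw [div_lt_one (by positivity)]
      nlinarith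

theorem tendsto_ncard_primitivePts {A m : ℤ} (hm : 0 < m) :
    Tendsto (fun T : ℝ => ((primitivePts A m T).ncard : ℝ) / (T * Real.log T)) atTop
      (𝓝 (3 / (π ^ 2 * m))) := by
  have hlim : ∑' d : ℕ, (ArithmeticFunction.moebius d : ℝ) * (1 / (2 * m) * (1 / (d : ℝ) ^ 2)) =
      3 / (π ^ 2 * m) := by
    have h : ∀ d : ℕ, (ArithmeticFunction.moebius d : ℝ) * (1 / (2 * m) * (1 / (d : ℝ) ^ 2)) =
        1 / (2 * m) * ((ArithmeticFunction.moebius d : ℝ) * (1 / (d : ℝ) ^ 2)) :=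
      fun d => by ring
    simp_rw [h]
    rw [tsum_mul_left, tsum_moebius_div_sq]
    have hm0 : (m : ℝ) ≠ 0 := by exact_mod_cast hm.ne'
    have hpi := Real.pi_pos
    field_simp
    norm_num
  rw [← hlim]
  have hsum : ∀ T : ℝ, ((primitivePts A m T).ncard : ℝ) / (T * Real.log T) =
      ∑' d : ℕ, (ArithmeticFunction.moebius d : ℝ) *
        (((hyperbolaPts A m (T / d ^ 2)).ncard : ℝ) / (T * Real.log T)) := by
    intro T
    rw [ncard_primitivePts hm, ← tsum_div_const]
    exact tsum_congr fun d => mul_div_assoc _ _ _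
  simp_rw [hsum]
  refine tendsto_tsum_of_dominated_convergence (bound := fun d : ℕ => 3 * (1 / (d : ℝ) ^ 2))
    ((Real.summable_one_div_nat_pow.2 one_lt_two).mul_left 3) ?_ ?_
  · intro d
    rcases eq_or_ne d 0 with rfl | hd
    · simp
    · exact (tendsto_ncard_hyperbolaPts_div_sq hm hd).const_mul _
  · filter_upwards [eventually_gt_atTop 1, Real.tendsto_log_atTop.eventually_ge_atTop 1]
      with T hT hl d
    have hT0 : 0 < T := by linarith
    have hl0 : 0 < Real.log T := by linarith
    have hmu : |(ArithmeticFunction.moebius d : ℝ)| ≤ 1 := by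
      exact_mod_cast ArithmeticFunction.abs_moebius_le_one (n := d)
    rcases eq_or_ne d 0 with rfl | hd
    · simp
    have hd1 : (1 : ℝ) ≤ (d : ℝ) ^ 2 :=
      one_le_pow₀ (by exact_mod_cast Nat.pos_of_ne_zero hd)
    have hle := ncard_hyperbolaPts_le (A := A) hm (X := T / (d : ℝ) ^ 2) (by positivity) hl0.le
      fun h => Real.log_le_log (by linarith) (div_le_self hT0.le hd1)
    rw [norm_mul, Real.norm_eq_abs, Real.norm_eq_abs,
      abs_of_nonneg (a := _ / _) (by positivity)]
    calc _ ≤ 1 * (((hyperbolaPts A m (T / d ^ 2)).ncard : ℝ) / (T * Real.log T)) := by gcongr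
      _ ≤ 1 * (T / (d : ℝ) ^ 2 * (3 * Real.log T) / (T * Real.log T)) := by
        gcongr
        exact hle.trans (by gcongr; linarith)
      _ = 3 * (1 / (d : ℝ) ^ 2) := by field_simp

theorem tendsto_ncard_positivePairs {m : ℤ} (hm : 0 < m) {Q : ℤ × ℤ × ℤ}
    (hQ : Q.2.1 ^ 2 - 4 * Q.1 * Q.2.2 = 4 * m ^ 2) :
    Tendsto (fun T : ℝ => ((positivePairs m Q T).ncard : ℝ) / (T * Real.log T)) atTop
      (𝓝 (3 / (π ^ 2 * m))) := by
  obtain ⟨A, hA⟩ := exists_properEquiv_split hm hQ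
  have hup := tendsto_ncard_primitivePts (A := A) hm
  have hlow := hup.sub (Real.tendsto_log_atTop.const_div_atTop (4 * (m : ℝ)))
  rw [sub_zero] at hlow
  refine tendsto_of_tendsto_of_tendsto_of_le_of_le' hlow hup ?_ ?_
  · filter_upwards [eventually_gt_atTop 1] with T hT
    have hT0 : 0 < T := by linarith
    have hl := Real.log_pos hT
    have h := ncard_primitivePts_le (A := A) hm hT0.le
    rw [ncard_positivePairs hm hA, sub_le_iff_le_add]
    calc _ ≤ (((positiveMatrices A m T).ncard : ℝ) + 4 * m * T) / (T * Real.log T) := by gcongr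
      _ = _ := by field_simp
  · filter_upwards [eventually_gt_atTop 1] with T hT
    have hl := Real.log_pos hT
    rw [ncard_positivePairs hm hA]
    gcongr
    exact ncard_positiveMatrices_le hm T

theorem tendsto_ncard_signedPairs {m : ℤ} (hm : 0 < m) {Q : ℤ × ℤ × ℤ}
    (hQ : Q.2.1 ^ 2 - 4 * Q.1 * Q.2.2 = 4 * m ^ 2) :
    Tendsto (fun T : ℝ => ((signedPairs m Q T).ncard : ℝ) / (T * Real.log T)) atTop
      (𝓝 (6 / (π ^ 2 * m))) := by
  have hneg : (-Q).2.1 ^ 2 - 4 * (-Q).1 * (-Q).2.2 = 4 * m ^ 2 := by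
    simp only [Prod.fst_neg, Prod.snd_neg]
    linarith
  have hlow := (tendsto_ncard_positivePairs hm hQ).add (tendsto_ncard_positivePairs hm hneg)
  have hup := hlow.add ((tendsto_id.atTop_mul_atTop₀ Real.tendsto_log_atTop).const_div_atTop
    ((Set.Icc ((-m ^ 2, -m ^ 2) : ℤ × ℤ) (m ^ 2, m ^ 2)).ncard : ℝ))
  have h6 : (3 : ℝ) / (π ^ 2 * m) + 3 / (π ^ 2 * m) = 6 / (π ^ 2 * m) := by ring
  rw [add_zero] at hup
  rw [h6] at hlow hup
  refine tendsto_of_tendsto_of_tendsto_of_le_of_le' hlow hup ?_ ?_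
  · filter_upwards [eventually_gt_atTop 1] with T hT
    have hl := Real.log_pos hT
    rw [← add_div]
    gcongr
    exact_mod_cast (ncard_signedPairs_bounds m Q T).1
  · filter_upwards [eventually_gt_atTop 1] with T hT
    have hl := Real.log_pos hT
    simp only [id_eq]
    rw [← add_div, ← add_div]
    gcongr
    exact_mod_cast (ncard_signedPairs_bounds m Q T).2

/-- **Theorem 1 (c).** For a positive perfect square `n` and an integral binary quadratic
form `Q` of discriminant `4n`, as `T → ∞` one has
`D_T^Q = 6 T log T / (π² n^{1/2}) + o(T log T)`. -/
theorem equidistribution_split (n : ℤ) (hn : 0 < n) (hsq : ∃ m : ℤ, n = m ^ 2)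
    (Q : ℤ × ℤ × ℤ) (hdisc : Q.2.1 ^ 2 - 4 * Q.1 * Q.2.2 = 4 * n) :
    (fun T : ℝ => (DTQ n Q T : ℝ) -
        6 * T * Real.log T / (Real.pi ^ 2 * Real.sqrt (n : ℝ)))
      =o[atTop] (fun T : ℝ => T * Real.log T) := by
  obtain ⟨k, rfl⟩ := hsq
  obtain ⟨m, hm, hmk⟩ : ∃ m : ℤ, 0 < m ∧ k ^ 2 = m ^ 2 :=
    ⟨|k|, abs_pos.2 (pow_ne_zero_iff two_ne_zero |>.1 hn.ne'), (sq_abs k).symm⟩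
  rw [hmk] at hdisc ⊢
  have hm0 : (0 : ℝ) < m := Int.cast_pos.2 hm
  have hsqrt : √((m ^ 2 : ℤ) : ℝ) = m := by
    push_cast
    exact Real.sqrt_sq hm0.le
  rw [hsqrt, isLittleO_iff_tendsto']
  · have h := (tendsto_ncard_signedPairs hm hdisc).sub_const (6 / (π ^ 2 * m))
    rw [sub_self] at h
    refine h.congr' ?_
    filter_upwards [eventually_gt_atTop 1] with T hT
    have hl := Real.log_pos hT
    have hT0 : 0 < T := by linarith
    have hpi := Real.pi_pos
    rw [show DTQ (m ^ 2) Q T = (signedPairs m Q T).ncard from rfl]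
    field_simp
  · filter_upwards [eventually_gt_atTop 1] with T hT h
    have hl := Real.log_pos hT
    have hT0 : 0 < T := by linarith
    exact absurd h (by positivity)
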